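/- Let T = {(x,y) ∈ ℝ² : x ≥ 0, y ≥ 0, x + y ≤ 1} and let b(x,y) = x·y·(1 − x − y) be its bubble function. For all real numbers α, β with −1/2 < α ≤ β, there exists a constant c > 0 (depending only on α and β) such that for every integer p ≥ 1 and every real polynomial q in two variables of total degree at most p, ∫_T b(x,y)^α q(x,y)² dx dy ≤ c · p^{4(β−α)} · ∫_T b(x,y)^β q(x,y)² dx dy. -/

import Mathlib

open MeasureTheory

/-- The reference triangle `T = {(x,y) : x ≥ 0, y ≥ 0, x + y ≤ 1}`. -/
def refTriangle : Set (ℝ × ℝ) := {z | 0 ≤ z.1 ∧ 0 ≤ z.2 ∧ z.1 + z.2 ≤ 1}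

lemma bie_sym_bound {V : Type*} [NormedAddCommGroup V] [InnerProductSpace ℝ V]
    [FiniteDimensional ℝ V] (T : V →ₗ[ℝ] V) (hT : T.IsSymmetric) (Λ : ℝ)
    (h : ∀ (μ : ℝ) (v : V), v ≠ 0 → T v = μ • v → μ ≤ Λ) (v : V) :
    inner ℝ (T v) v ≤ Λ * inner ℝ v v := by
  have hn : Module.finrank ℝ V = Module.finrank ℝ V := rfl
  set B := hT.eigenvectorBasis hn
  have h1 : ∀ i, hT.eigenvalues hn i ≤ Λ := by
    intro i
    refine h _ (B i) (B.orthonormal.ne_zero i) ?_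
    exact hT.apply_eigenvectorBasis hn i
  rw [← B.sum_inner_mul_inner (T v) v, ← B.sum_inner_mul_inner v v, Finset.mul_sum]
  refine Finset.sum_le_sum fun i _ => ?_
  rw [hT, hT.apply_eigenvectorBasis hn i]
  have := real_inner_comm (B i) v
  simp only [inner_smul_right, RCLike.ofReal_real_eq_id, id]
  rw [← this]
  nlinarith [h1 i, mul_self_nonneg (inner ℝ (B i) v)]

lemma bie_integrable {a : ℝ} (ha : -1 < a) {f : ℝ → ℝ} (hf : Continuous f) (u v : ℝ) :
    IntervalIntegrable (fun x => x ^ a * f x) volume u v :=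
  (intervalIntegral.intervalIntegrable_rpow' ha).mul_continuousOn hf.continuousOn

open Polynomial in
noncomputable def bieL (a : ℝ) : ℝ[X] →ₗ[ℝ] ℝ[X] :=
  (LinearMap.mulLeft ℝ (X ^ 2 - X)) ∘ₗ derivative ∘ₗ derivative +
    (LinearMap.mulLeft ℝ (C (a + 2) * X - C (a + 1))) ∘ₗ derivative

open Polynomial in
lemma bieL_apply (a : ℝ) (q : ℝ[X]) : bieL a q =
    (X ^ 2 - X) * derivative (derivative q) + (C (a + 2) * X - C (a + 1)) * derivative q := by
  simp [bieL]

open Polynomial in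
lemma bieL_coeff (a : ℝ) (q : ℝ[X]) (n : ℕ) : (bieL a q).coeff n =
    n * (n + a + 1) * q.coeff n - (n + 1) * (n + a + 1) * q.coeff (n + 1) := by
  rw [bieL_apply]
  simp only [sub_mul, coeff_add, coeff_sub, mul_assoc, coeff_C_mul, pow_two]
  rcases n with _ | _ | n
  · simp [coeff_derivative]
  · simp [coeff_derivative, coeff_X_mul]
    ring
  · simp [coeff_derivative, coeff_X_mul]
    ring

open Polynomial in
lemma bieL_symm {a : ℝ} (ha : -1 < a) (q r : ℝ[X]) :
    ∫ x in (0:ℝ)..1, x ^ a * ((bieL a q).eval x * r.eval x) =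
      ∫ x in (0:ℝ)..1, x ^ (a + 1) * ((1 - x) * (derivative q).eval x * (derivative r).eval x) := by
  have i1 := bie_integrable ha (f := fun x => (bieL a q).eval x * r.eval x) (by fun_prop) 0 1
  have i2 := bie_integrable (a := a + 1) (by linarith)
    (f := fun x => (1 - x) * (derivative q).eval x * (derivative r).eval x) (by fun_prop) 0 1
  rw [← sub_eq_zero, ← intervalIntegral.integral_sub i1 i2]
  have := intervalIntegral.integral_eq_sub_of_hasDerivAt_of_le (a := (0:ℝ)) (b := 1) zero_le_one
    (f := fun x => -(x ^ (a + 1) * ((1 - x) * (derivative q).eval x * r.eval x))) (f' := fun x =>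
      x ^ a * ((bieL a q).eval x * r.eval x) -
      x ^ (a + 1) * ((1 - x) * (derivative q).eval x * (derivative r).eval x)) ?_ ?_ (i1.sub i2)
  · rw [this]
    have : a + 1 ≠ 0 := by linarith
    simp [this]
  · refine ContinuousOn.neg (ContinuousOn.mul ?_ (by fun_prop))
    exact continuousOn_id.rpow_const (fun x _ => Or.inr (by linarith))
  · intro x hx
    have h1 : HasDerivAt (fun x : ℝ => x ^ (a + 1)) ((a + 1) * x ^ a) x := by
      simpa using Real.hasDerivAt_rpow_const (x := x) (p := a + 1) (Or.inl hx.1.ne')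
    have h2 := (((hasDerivAt_id x).const_sub 1).mul ((derivative q).hasDerivAt x)).mul
      (r.hasDerivAt x)
    have h3 := (h1.mul h2).neg
    refine h3.congr_deriv ?_
    rw [bieL_apply, Real.rpow_add_one hx.1.ne']
    simp
    ring

open Polynomial in
@[reducible] noncomputable def bieCore (a : ℝ) (ha : -1 < a) (n : ℕ) :
    InnerProductSpace.Core ℝ (degreeLT ℝ n) where
  inner q r := ∫ x in (0:ℝ)..1, x ^ a * ((q : ℝ[X]).eval x * (r : ℝ[X]).eval x)
  conj_inner_symm q r := by
    simp [mul_comm]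
  re_inner_nonneg q := by
    simp only [RCLike.re_to_real]
    refine intervalIntegral.integral_nonneg zero_le_one fun x hx => ?_
    exact mul_nonneg (Real.rpow_nonneg hx.1 _) (mul_self_nonneg _)
  add_left q r s := by
    rw [← intervalIntegral.integral_add]
    · simp [add_mul, mul_add]
    · exact bie_integrable ha (by fun_prop) _ _
    · exact bie_integrable ha (by fun_prop) _ _
  smul_left q r c := by
    simp only [conj_trivial]
    rw [← intervalIntegral.integral_const_mul]
    congr 1
    ext x
    simp
    ring
  definite q hq := by
    by_contra hne
    have hne' : (q : ℝ[X]) ≠ 0 := by simpa using hne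
    have i1 := bie_integrable ha (f := fun x => (q : ℝ[X]).eval x * (q : ℝ[X]).eval x)
      (by fun_prop) 0 1
    rw [intervalIntegral.integral_eq_zero_iff_of_le_of_nonneg_ae zero_le_one ?_ i1] at hq
    · have hfin : (((q : ℝ[X]).roots.toFinset : Set ℝ))ᶜ ∈ ae (volume.restrict (Set.Ioc (0:ℝ) 1)) := by
        rw [mem_ae_iff, compl_compl]
        exact (Finset.finite_toSet _).measure_zero _
      have hI := ae_restrict_mem (μ := volume) (measurableSet_Ioc (a := (0:ℝ)) (b := 1))
      have hF : ∀ᵐ x ∂(volume.restrict (Set.Ioc (0:ℝ) 1)), False := by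
        filter_upwards [hq, hfin, hI] with x h1 h2 h3
        have h4 : x ^ a ≠ 0 := (Real.rpow_pos_of_pos h3.1 a).ne'
        simp [h4] at h1
        exact h2 (by simp [hne', h1])
      rw [ae_iff] at hF
      simp at hF
    · filter_upwards [ae_restrict_mem measurableSet_Ioc] with x hx
      exact mul_nonneg (Real.rpow_nonneg hx.1.le _) (mul_self_nonneg _)

open Polynomial in
lemma bie_bernstein {a : ℝ} (ha : -1 < a) (p : ℕ) (q : ℝ[X]) (hq : q.natDegree ≤ p) :
    ∫ x in (0:ℝ)..1, x ^ (a + 1) * ((1 - x) * (derivative q).eval x * (derivative q).eval x) ≤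
      (p * (p + a + 1)) * ∫ x in (0:ℝ)..1, x ^ a * (q.eval x * q.eval x) := by
  rw [← bieL_symm ha]
  let _ : NormedAddCommGroup (degreeLT ℝ (p + 1)) := (bieCore a ha (p + 1)).toNormedAddCommGroup
  let _ : InnerProductSpace ℝ (degreeLT ℝ (p + 1)) := InnerProductSpace.ofCore (bieCore a ha (p + 1)).toCore
  have hmem : ∀ r ∈ degreeLT ℝ (p + 1), bieL a r ∈ degreeLT ℝ (p + 1) := by
    intro r hr
    rw [mem_degreeLT, degree_lt_iff_coeff_zero] at hr ⊢
    intro m hm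
    rw [bieL_coeff, hr m hm, hr (m + 1) (by omega)]
    simp
  have _ : FiniteDimensional ℝ (degreeLT ℝ (p + 1)) :=
    (degreeLTEquiv ℝ (p + 1)).symm.finiteDimensional
  have hin : ∀ r s : degreeLT ℝ (p + 1), inner ℝ r s =
      ∫ x in (0:ℝ)..1, x ^ a * ((r : ℝ[X]).eval x * (s : ℝ[X]).eval x) := fun r s => rfl
  have hq' : q ∈ degreeLT ℝ (p + 1) := by
    rw [mem_degreeLT, degree_lt_iff_coeff_zero]
    intro m hm
    exact coeff_eq_zero_of_natDegree_lt (by omega)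
  have := bie_sym_bound ((bieL a).restrict hmem) ?_ (p * (p + a + 1)) ?_ ⟨q, hq'⟩
  · exact this
  · intro r s
    simp only [hin, LinearMap.coe_restrict_apply]
    rw [bieL_symm ha]
    have : ∀ x : ℝ, x ^ a * ((r : ℝ[X]).eval x * (bieL a s).eval x) =
      x ^ a * ((bieL a s).eval x * (r : ℝ[X]).eval x) := fun x => by ring
    simp_rw [this]
    rw [bieL_symm ha]
    congr 1
    ext x
    ring
  · intro μ v hv h
    have hv' : (v : ℝ[X]) ≠ 0 := by simpa using hv
    have h1 : bieL a v = μ • (v : ℝ[X]) := by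
      have := congrArg Subtype.val h
      simpa using this
    have h2 := congrArg (fun r => r.coeff (v : ℝ[X]).natDegree) h1
    simp only [bieL_coeff, coeff_smul, smul_eq_mul,
      coeff_eq_zero_of_natDegree_lt (Nat.lt_succ_self (v : ℝ[X]).natDegree)] at h2
    rw [mul_zero, sub_zero] at h2
    have h3 := mul_right_cancel₀ (by simpa using hv') h2
    rw [← h3]
    have h4 : ((v : ℝ[X]).natDegree : ℝ) ≤ p := by
      have := mem_degreeLT.1 v.2
      rw [degree_eq_natDegree hv'] at this
      exact_mod_cast Nat.lt_succ_iff.1 (by exact_mod_cast this)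
    have h5 : (0:ℝ) ≤ ((v : ℝ[X]).natDegree : ℝ) := by positivity
    nlinarith

lemma bie_pointwise {e h κ δ x Q Q' : ℝ} (hκ : κ = e + 1) (hκ0 : 0 < κ) (hh : 0 ≤ h)
    (hh1 : h ≤ 1) (hδ : 0 < δ) (hδ2 : δ ≤ 1 / 2) (hx : 0 < x) (hxδ : x ≤ δ) :
    x ^ e * (Q * Q) ≤ (4 / κ) * (κ * x ^ e * ((1 - x / δ) * (Q * Q)) +
        x ^ κ * (-(1 / δ) * (Q * Q) + (1 - x / δ) * (2 * Q * Q'))) +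
      (((4 / κ) * δ ^ (-h) + (δ / 2) ^ (-h)) * (x ^ (e + h) * (Q * Q)) +
       (16 / κ ^ 2 * (δ * δ ^ (-h))) * (x ^ (e + h + 1) * ((1 - x) * Q' * Q'))) := by
  have e1 : x ^ κ = x * x ^ e := by rw [hκ, Real.rpow_add_one hx.ne', mul_comm]
  have e2 : x ^ (e + h) = x ^ e * x ^ h := Real.rpow_add hx _ _
  have e3 : x ^ (e + h + 1) = x * x ^ e * x ^ h := by
    rw [Real.rpow_add_one hx.ne', e2]; ring
  have e4 : δ ^ (-h) * δ ^ h = 1 := by rw [← Real.rpow_add hδ]; simp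
  -- δ^{-h} x^h ≥ x/δ
  set ρ := x / δ with hρ
  have hρ0 : 0 < ρ := by positivity
  have hρ1 : ρ ≤ 1 := (div_le_one hδ).2 hxδ
  have e5 : δ ^ (-h) * x ^ h = ρ ^ h := by
    rw [hρ, Real.div_rpow hx.le hδ.le, Real.rpow_neg hδ.le]; field_simp
  have e6 : (δ / 2) ^ (-h) * x ^ h = (2 * ρ) ^ h := by
    have : 2 * ρ = x / (δ / 2) := by rw [hρ]; field_simp
    rw [this, Real.div_rpow hx.le (by positivity), Real.rpow_neg (by positivity)]; field_simp
  have e7 : ρ ≤ ρ ^ h := by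
    simpa using Real.rpow_le_rpow_of_exponent_ge hρ0 hρ1 hh1
  have hx' : x = ρ * δ := by rw [hρ]; field_simp
  set w := x ^ e with hw
  have hw0 : 0 < w := Real.rpow_pos_of_pos hx _
  have hx2 : 1 / 2 ≤ 1 - x := by linarith
  have k1 : (1:ℝ) ≤ 2 * (1 - ρ) + (2 * ρ) ^ h := by
    rcases le_total (2 * ρ) 1 with h1 | h1
    · have : 0 ≤ (2 * ρ) ^ h := by positivity
      linarith
    · have := Real.one_le_rpow h1 hh
      linarith
  rw [e1, e2, e3]
  have goal' : 0 ≤ w * ( (4 * (1 - ρ) - 1 + (2 * ρ) ^ h) * (Q * Q) + (4 / κ) * (ρ ^ h - ρ) * (Q * Q)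
     + (4 / κ) * x * (1 - ρ) * (2 * Q * Q') + 16 / κ ^ 2 * δ * x * ρ ^ h * (1 - x) * Q' ^ 2) := by
    apply mul_nonneg hw0.le
    have t1 : 0 ≤ (4 / κ) * (ρ ^ h - ρ) * (Q * Q) :=
      mul_nonneg (mul_nonneg (by positivity) (by linarith)) (mul_self_nonneg _)
    have t2 : 16 / κ ^ 2 * δ * x * ρ ^ h * (1 - x) * Q' ^ 2 ≥ 8 / κ ^ 2 * x ^ 2 * Q' ^ 2 := by
      have : δ * x * ρ ^ h * (1 - x) ≥ x ^ 2 * (1 / 2) := by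
        have : δ * x * ρ ^ h ≥ x ^ 2 := by
          have := mul_le_mul_of_nonneg_left e7 (by positivity : 0 ≤ δ * x)
          calc x ^ 2 = δ * x * ρ := by nth_rewrite 1 [pow_two]; nth_rewrite 1 [hx']; ring
            _ ≤ _ := this
        nlinarith [sq_nonneg x]
      calc 8 / κ ^ 2 * x ^ 2 * Q' ^ 2 = (16 / κ ^ 2 * Q' ^ 2) * (x ^ 2 * (1 / 2)) := by ring
        _ ≤ (16 / κ ^ 2 * Q' ^ 2) * (δ * x * ρ ^ h * (1 - x)) :=
          mul_le_mul_of_nonneg_left this (by positivity)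
        _ = _ := by ring
    have t3 : (4 * (1 - ρ) - 1 + (2 * ρ) ^ h) * (Q * Q) ≥ 2 * (1 - ρ) * (Q * Q) :=
      mul_le_mul_of_nonneg_right (by linarith) (mul_self_nonneg _)
    set y := x * Q' / κ with hy
    have t4 : (4 / κ) * x * (1 - ρ) * (2 * Q * Q') = (1 - ρ) * (8 * Q * y) := by
      rw [hy]; field_simp; ring
    have t5 : 8 / κ ^ 2 * x ^ 2 * Q' ^ 2 = 8 * y ^ 2 := by rw [hy]; field_simp
    have t6 : 0 ≤ (1 - ρ) * (2 * (Q + 2 * y) ^ 2) :=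
      mul_nonneg (by linarith) (by positivity)
    have t7 : 0 ≤ ρ * y ^ 2 := by positivity
    rw [t4]
    rw [t5] at t2
    nlinarith
  rw [← sub_nonneg]
  refine goal'.trans_eq ?_
  rw [← e5, ← e6]
  have : x * (1 / δ) = ρ := by rw [hρ]; ring
  rw [← this]
  field_simp
  ring

open Polynomial in
lemma bie_step {e h : ℝ} (he : -1 < e) (hh : 0 ≤ h) (hh1 : h ≤ 1) :
    ∃ C : ℝ, 0 < C ∧ ∀ (p : ℕ) (q : ℝ[X]), 1 ≤ p → q.natDegree ≤ p →
      ∫ x in (0:ℝ)..1, x ^ e * (q.eval x * q.eval x) ≤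
        C * ((p : ℝ) ^ 2) ^ h * ∫ x in (0:ℝ)..1, x ^ (e + h) * (q.eval x * q.eval x) := by
  have hκ : 0 < e + 1 := by linarith
  obtain ⟨κ, hκe⟩ : ∃ κ, κ = e + 1 := ⟨_, rfl⟩
  have hκ0 : 0 < κ := by rw [hκe]; exact hκ
  refine ⟨8 / κ + 4 + 16 / κ ^ 2 * (e + h + 2), by
    have : 0 < e + h + 2 := by linarith
    positivity, fun p q hp hq => ?_⟩
  have hp' : (1:ℝ) ≤ p := by exact_mod_cast hp
  set N := (p:ℝ) ^ 2 with hN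
  have hN1 : 1 ≤ N := one_le_pow₀ hp'
  set δ := 1 / (2 * N) with hδ
  have hδ0 : 0 < δ := by positivity
  have hδ2 : δ ≤ 1 / 2 := by
    rw [hδ]; gcongr; linarith
  set B := ∫ x in (0:ℝ)..1, x ^ (e + h) * (q.eval x * q.eval x) with hB
  set D := ∫ x in (0:ℝ)..1, x ^ (e + h + 1) *
    ((1 - x) * (derivative q).eval x * (derivative q).eval x) with hD
  have hB0 : 0 ≤ B := intervalIntegral.integral_nonneg zero_le_one fun x hx =>
    mul_nonneg (Real.rpow_nonneg hx.1 _) (mul_self_nonneg _)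
  have hDB : D ≤ (p * (p + (e + h) + 1)) * B := bie_bernstein (by linarith) p q hq
  set K1 := (4 / κ) * δ ^ (-h) + (δ / 2) ^ (-h) with hK1
  set K2 := 16 / κ ^ 2 * (δ * δ ^ (-h)) with hK2
  have hK10 : 0 ≤ K1 := by positivity
  have hK20 : 0 ≤ K2 := by positivity
  have iE : ∀ u v, IntervalIntegrable (fun x => x ^ e * (q.eval x * q.eval x)) volume u v :=
    fun u v => bie_integrable he (by fun_prop) u v
  have iB : ∀ u v, IntervalIntegrable (fun x => x ^ (e + h) * (q.eval x * q.eval x)) volume u v :=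
    fun u v => bie_integrable (by linarith) (by fun_prop) u v
  have iD : ∀ u v, IntervalIntegrable (fun x => x ^ (e + h + 1) *
    ((1 - x) * (derivative q).eval x * (derivative q).eval x)) volume u v :=
    fun u v => bie_integrable (by linarith) (by fun_prop) u v
  set G : ℝ → ℝ := fun x => K1 * (x ^ (e + h) * (q.eval x * q.eval x)) +
    K2 * (x ^ (e + h + 1) * ((1 - x) * (derivative q).eval x * (derivative q).eval x)) with hG
  have iG : ∀ u v, IntervalIntegrable G volume u v :=
    fun u v => ((iB u v).const_mul _).add ((iD u v).const_mul _)
  set Φ : ℝ → ℝ := fun x => κ * x ^ e * ((1 - x / δ) * (q.eval x * q.eval x)) +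
        x ^ κ * (-(1 / δ) * (q.eval x * q.eval x) +
          (1 - x / δ) * (2 * q.eval x * (derivative q).eval x)) with hΦ
  have iΦ : IntervalIntegrable Φ volume 0 δ := by
    refine IntervalIntegrable.add ?_ ?_
    · simp_rw [mul_assoc]
      exact (bie_integrable he (by fun_prop) _ _).const_mul _
    · exact bie_integrable (by linarith) (by fun_prop) _ _
  have hΦ0 : ∫ x in (0:ℝ)..δ, Φ x = 0 := by
    rw [intervalIntegral.integral_eq_sub_of_hasDerivAt_of_le (a := (0:ℝ)) (b := δ) hδ0.le
      (f := fun x => x ^ κ * ((1 - x / δ) * (q.eval x * q.eval x))) ?_ ?_ iΦ]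
    · simp [hκ0.ne', hδ0.ne']
    · refine ContinuousOn.mul ?_ (by fun_prop)
      exact continuousOn_id.rpow_const (fun x _ => Or.inr hκ0.le)
    · intro x hx
      have h1 : HasDerivAt (fun x : ℝ => x ^ κ) (κ * x ^ e) x := by
        have := Real.hasDerivAt_rpow_const (x := x) (p := κ) (Or.inl hx.1.ne')
        rwa [show κ - 1 = e by linarith] at this
      have h2 := (((hasDerivAt_id x).div_const δ).const_sub 1).mul
        ((q.hasDerivAt x).mul (q.hasDerivAt x))
      refine (h1.mul h2).congr_deriv ?_
      simp only [hΦ, Pi.mul_apply, id]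
      ring
  have s1 : ∫ x in (0:ℝ)..δ, x ^ e * (q.eval x * q.eval x) ≤ ∫ x in (0:ℝ)..δ, G x := by
    have : ∫ x in (0:ℝ)..δ, x ^ e * (q.eval x * q.eval x) ≤
        ∫ x in (0:ℝ)..δ, ((4 / κ) * Φ x + G x) := by
      refine intervalIntegral.integral_mono_on_of_le_Ioo hδ0.le (iE _ _)
        ((iΦ.const_mul _).add (iG _ _)) fun x hx => ?_
      exact bie_pointwise hκe hκ0 hh hh1 hδ0 hδ2 hx.1 hx.2.le
    rwa [intervalIntegral.integral_add (iΦ.const_mul _) (iG _ _),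
      intervalIntegral.integral_const_mul, hΦ0, mul_zero, zero_add] at this
  have s2 : ∫ x in δ..(1:ℝ), x ^ e * (q.eval x * q.eval x) ≤ ∫ x in δ..(1:ℝ), G x := by
    refine intervalIntegral.integral_mono_on_of_le_Ioo (by linarith) (iE _ _) (iG _ _) fun x hx => ?_
    have hx0 : 0 < x := hδ0.trans hx.1
    have hQ := mul_self_nonneg (q.eval x)
    have hQ' := mul_self_nonneg ((derivative q).eval x)
    have t1 : 0 ≤ K2 * (x ^ (e + h + 1) * ((1 - x) * (derivative q).eval x * (derivative q).eval x)) := by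
      rw [mul_assoc (1 - x)]
      exact mul_nonneg hK20 (mul_nonneg (Real.rpow_nonneg hx0.le _)
        (mul_nonneg (by linarith [hx.2]) hQ'))
    have t2 : x ^ e ≤ K1 * x ^ (e + h) := by
      rw [Real.rpow_add hx0]
      have hxe := Real.rpow_pos_of_pos hx0 e
      have : 1 ≤ (δ / 2) ^ (-h) * x ^ h := by
        rw [Real.rpow_neg (by positivity), ← div_eq_inv_mul, ← Real.div_rpow hx0.le (by positivity)]
        refine Real.one_le_rpow ?_ hh
        rw [one_le_div (by positivity)]
        linarith [hx.1]
      have t3 : 1 ≤ K1 * x ^ h := by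
        rw [hK1, add_mul]
        have : 0 ≤ 4 / κ * δ ^ (-h) * x ^ h := by positivity
        linarith
      nlinarith
    simp only [hG]
    nlinarith [mul_le_mul_of_nonneg_right t2 hQ]
  have s3 : ∫ x in (0:ℝ)..1, G x = K1 * B + K2 * D := by
    simp only [hG]
    rw [intervalIntegral.integral_add ((iB _ _).const_mul _) ((iD _ _).const_mul _),
      intervalIntegral.integral_const_mul, intervalIntegral.integral_const_mul]
  have s4 : ∫ x in (0:ℝ)..1, x ^ e * (q.eval x * q.eval x) ≤ K1 * B + K2 * D := by
    rw [← s3, ← intervalIntegral.integral_add_adjacent_intervals (iE 0 δ) (iE δ 1),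
      ← intervalIntegral.integral_add_adjacent_intervals (iG 0 δ) (iG δ 1)]
    exact add_le_add s1 s2
  have hNh : 0 < N ^ h := by positivity
  have d1 : δ ^ (-h) ≤ 2 * N ^ h := by
    rw [hδ, one_div, Real.inv_rpow (by positivity), ← Real.rpow_neg (by positivity), neg_neg,
      Real.mul_rpow (by positivity) (by positivity)]
    have : (2:ℝ) ^ h ≤ 2 ^ (1:ℝ) := Real.rpow_le_rpow_of_exponent_le (by norm_num) hh1
    rw [Real.rpow_one] at this
    gcongr
  have d2 : (δ / 2) ^ (-h) ≤ 4 * N ^ h := by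
    have : δ / 2 = (4 * N)⁻¹ := by rw [hδ]; field_simp; norm_num
    rw [this, Real.inv_rpow (by positivity), ← Real.rpow_neg (by positivity), neg_neg,
      Real.mul_rpow (by positivity) (by positivity)]
    have : (4:ℝ) ^ h ≤ 4 ^ (1:ℝ) := Real.rpow_le_rpow_of_exponent_le (by norm_num) hh1
    rw [Real.rpow_one] at this
    gcongr
  have d3 : δ * (p * (p + (e + h) + 1)) ≤ (e + h + 2) / 2 := by
    rw [hδ, div_mul_eq_mul_div, one_mul, div_le_div_iff₀ (by positivity) (by norm_num), hN]
    nlinarith [mul_nonneg (by linarith : 0 ≤ e + h + 1) (mul_nonneg (by linarith : (0:ℝ) ≤ p) (by linarith : (0:ℝ) ≤ p - 1))]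
  have d4 : K1 + K2 * (p * (p + (e + h) + 1)) ≤ (8 / κ + 4 + 16 / κ ^ 2 * (e + h + 2)) * N ^ h := by
    have u1 : K1 ≤ 4 / κ * (2 * N ^ h) + 4 * N ^ h := by
      rw [hK1]; gcongr
    have u2 : K2 * (p * (p + (e + h) + 1)) ≤ 16 / κ ^ 2 * ((e + h + 2) / 2 * (2 * N ^ h)) := by
      have : K2 * (p * (p + (e + h) + 1)) =
        16 / κ ^ 2 * ((δ * (p * (p + (e + h) + 1))) * δ ^ (-h)) := by rw [hK2]; ring
      rw [this]
      have : 0 ≤ e + h + 2 := by linarith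
      gcongr
    calc _ ≤ _ := add_le_add u1 u2
      _ = _ := by ring
  calc _ ≤ _ := s4
    _ ≤ K1 * B + K2 * ((p * (p + (e + h) + 1)) * B) := by gcongr
    _ = (K1 + K2 * (p * (p + (e + h) + 1))) * B := by ring
    _ ≤ _ := by gcongr

open Polynomial in
lemma bie_steps {h : ℝ} (hh : 0 ≤ h) (hh1 : h ≤ 1) (n : ℕ) : ∀ {e : ℝ}, -1 < e →
    ∃ C : ℝ, 0 < C ∧ ∀ (p : ℕ) (q : ℝ[X]), 1 ≤ p → q.natDegree ≤ p →
      ∫ x in (0:ℝ)..1, x ^ e * (q.eval x * q.eval x) ≤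
        C * ((p : ℝ) ^ 2) ^ (n * h) * ∫ x in (0:ℝ)..1, x ^ (e + n * h) * (q.eval x * q.eval x) := by
  induction n with
  | zero => intro e _; exact ⟨1, one_pos, fun p q _ _ => by simp⟩
  | succ n ih =>
    intro e he
    obtain ⟨C1, h1, H1⟩ := bie_step he hh hh1
    obtain ⟨C2, h2, H2⟩ := ih (e := e + h) (by linarith)
    refine ⟨C1 * C2, by positivity, fun p q hp hq => ?_⟩
    have hp' : (0:ℝ) < p := by exact_mod_cast hp
    have e1 : e + ((n + 1 : ℕ) : ℝ) * h = e + h + n * h := by push_cast; ring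
    have e2 : ((n + 1 : ℕ) : ℝ) * h = h + n * h := by push_cast; ring
    rw [e1, e2, Real.rpow_add (by positivity)]
    refine (H1 p q hp hq).trans ((mul_le_mul_of_nonneg_left (H2 p q hp hq) (by positivity)).trans_eq ?_)
    ring

open Polynomial in
lemma bie_oneD {e s : ℝ} (he : -1 < e) (hs : 0 ≤ s) :
    ∃ C : ℝ, 0 < C ∧ ∀ (p : ℕ) (q : ℝ[X]), 1 ≤ p → q.natDegree ≤ p →
      ∫ x in (0:ℝ)..1, x ^ e * (q.eval x * q.eval x) ≤
        C * ((p : ℝ) ^ 2) ^ s * ∫ x in (0:ℝ)..1, x ^ (e + s) * (q.eval x * q.eval x) := by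
  have hn : (0:ℝ) < (⌈s⌉₊ + 1 : ℕ) := by positivity
  have := bie_steps (h := s / (⌈s⌉₊ + 1 : ℕ)) (by positivity) (by
    rw [div_le_one hn]; push_cast; linarith [Nat.le_ceil s]) (⌈s⌉₊ + 1) he
  rwa [mul_div_cancel₀ _ hn.ne'] at this

lemma bie_rpow_bounds {y d : ℝ} (hy : 1 / 2 ≤ y) (hy1 : y ≤ 1) :
    (1 / 2 : ℝ) ^ |d| ≤ y ^ d ∧ y ^ d ≤ 2 ^ |d| := by
  have hy0 : 0 < y := by linarith
  constructor
  · calc (1 / 2 : ℝ) ^ |d| ≤ y ^ |d| := Real.rpow_le_rpow (by norm_num) hy (abs_nonneg _)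
      _ ≤ y ^ d := Real.rpow_le_rpow_of_exponent_ge hy0 hy1 (le_abs_self d)
  · calc y ^ d ≤ y ^ (-|d|) := Real.rpow_le_rpow_of_exponent_ge hy0 hy1 (neg_abs_le d)
      _ = (y⁻¹) ^ |d| := by rw [Real.rpow_neg hy0.le, Real.inv_rpow hy0.le]
      _ ≤ 2 ^ |d| := by
        refine Real.rpow_le_rpow (by positivity) ?_ (abs_nonneg _)
        rw [inv_le_comm₀ hy0 (by norm_num)]; linarith

open Polynomial in
lemma bie_half_eq (e : ℝ) (q : ℝ[X]) :
    ∫ x in (0:ℝ)..(1/2), x ^ e * (q.eval x * q.eval x) = (1 / 2) * (1 / 2) ^ e *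
      ∫ x in (0:ℝ)..1, x ^ e * ((q.comp (C (1 / 2) * X)).eval x * (q.comp (C (1 / 2) * X)).eval x) := by
  have h1 := intervalIntegral.integral_comp_mul_left (a := 0) (b := 1)
    (fun x : ℝ => x ^ e * (q.eval x * q.eval x)) (c := 1 / 2) (by norm_num)
  rw [mul_zero, mul_one] at h1
  have h2 : ∫ x in (0:ℝ)..1, ((1 / 2 : ℝ) * x) ^ e * (q.eval (1 / 2 * x) * q.eval (1 / 2 * x)) =
      (1 / 2) ^ e * ∫ x in (0:ℝ)..1, x ^ e * ((q.comp (C (1 / 2) * X)).eval x *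
        (q.comp (C (1 / 2) * X)).eval x) := by
    rw [← intervalIntegral.integral_const_mul]
    refine intervalIntegral.integral_congr fun x hx => ?_
    rw [Set.uIcc_of_le zero_le_one] at hx
    simp only [eval_comp, eval_mul, eval_C, eval_X]
    rw [Real.mul_rpow (by norm_num) hx.1]
    ring
  rw [h2] at h1
  rw [mul_assoc, h1]
  simp

open Polynomial in
lemma bie_half {e s : ℝ} (he : -1 < e) (hs : 0 ≤ s) :
    ∃ C : ℝ, 0 < C ∧ ∀ (p : ℕ) (q : ℝ[X]), 1 ≤ p → q.natDegree ≤ p →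
      ∫⁻ x in Set.Ioc (0:ℝ) (1/2), ENNReal.ofReal (x ^ e * (q.eval x * q.eval x)) ≤
        ENNReal.ofReal (C * ((p : ℝ) ^ 2) ^ s) *
          ∫⁻ x in Set.Ioc (0:ℝ) (1/2), ENNReal.ofReal (x ^ (e + s) * (q.eval x * q.eval x)) := by
  obtain ⟨C0, hC, H⟩ := bie_oneD he hs
  refine ⟨C0 * 2 ^ s, by positivity, fun p q hp hq => ?_⟩
  have key : ∀ e' : ℝ, -1 < e' →
      ∫⁻ x in Set.Ioc (0:ℝ) (1/2), ENNReal.ofReal (x ^ e' * (q.eval x * q.eval x)) =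
      ENNReal.ofReal (∫ x in (0:ℝ)..(1/2), x ^ e' * (q.eval x * q.eval x)) := by
    intro e' he'
    rw [intervalIntegral.integral_of_le (by norm_num), ofReal_integral_eq_lintegral_ofReal]
    · exact ((bie_integrable he' (f := fun x => q.eval x * q.eval x) (by fun_prop) 0 (1/2)).1)
    · filter_upwards [ae_restrict_mem measurableSet_Ioc] with x hx
      exact mul_nonneg (Real.rpow_nonneg hx.1.le _) (mul_self_nonneg _)
  rw [key e he, key (e + s) (by linarith), ← ENNReal.ofReal_mul (by positivity)]
  refine ENNReal.ofReal_le_ofReal ?_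
  have hdeg : (q.comp (C (1 / 2) * X)).natDegree ≤ p := by
    refine natDegree_comp_le.trans ?_
    have : (C (1 / 2 : ℝ) * X).natDegree ≤ 1 := (natDegree_C_mul_le _ _).trans natDegree_X_le
    nlinarith
  have := H p _ hp hdeg
  rw [bie_half_eq, bie_half_eq]
  refine (mul_le_mul_of_nonneg_left this (by positivity)).trans_eq ?_
  rw [Real.rpow_add (by norm_num)]
  have : (2:ℝ) ^ s * (1 / 2) ^ s = 1 := by
    rw [← Real.mul_rpow (by norm_num) (by norm_num)]; norm_num
  generalize ∫ x in (0:ℝ)..1, x ^ (e + s) * ((q.comp (C (1 / 2) * X)).eval x *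
        (q.comp (C (1 / 2) * X)).eval x) = I
  linear_combination (-(1 / 2) * (1 / 2) ^ e * C0 * (((p:ℝ) ^ 2) ^ s) * I) * this

open Polynomial in
lemma bie_oneD_w {e s : ℝ} (d : ℝ) (he : -1 < e) (hs : 0 ≤ s) :
    ∃ C : ℝ, 0 < C ∧ ∀ (p : ℕ) (q : ℝ[X]), 1 ≤ p → q.natDegree ≤ p →
      ∫⁻ x in Set.Ioo (0:ℝ) 1, ENNReal.ofReal (x ^ e * (1 - x) ^ d * (q.eval x) ^ 2) ≤
        ENNReal.ofReal (C * ((p : ℝ) ^ 2) ^ s) *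
          ∫⁻ x in Set.Ioo (0:ℝ) 1, ENNReal.ofReal (x ^ (e + s) * (1 - x) ^ d * (q.eval x) ^ 2) := by
  obtain ⟨C0, hC, H⟩ := bie_half he hs
  refine ⟨2 ^ |d| * C0 * 2 ^ |d| + 2 ^ s, by positivity, fun p q hp hq => ?_⟩
  have hp' : (1:ℝ) ≤ p := by exact_mod_cast hp
  set N := (p:ℝ) ^ 2 with hN
  have hN1 : 1 ≤ N := one_le_pow₀ hp'
  have hNs : 1 ≤ N ^ s := Real.one_le_rpow hN1 hs
  have hU : Set.Ioo (0:ℝ) 1 = Set.Ioc 0 (1/2) ∪ Set.Ioo (1/2) 1 :=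
    (Set.Ioc_union_Ioo_eq_Ioo (by norm_num) (by norm_num)).symm
  have hdisj : Disjoint (Set.Ioc (0:ℝ) (1/2)) (Set.Ioo (1/2) 1) := by
    rw [Set.disjoint_left]
    intro x hx hx'
    exact absurd hx.2 (not_le.2 hx'.1)
  rw [hU, lintegral_union measurableSet_Ioo hdisj, lintegral_union measurableSet_Ioo hdisj, mul_add]
  refine add_le_add ?_ ?_
  · calc ∫⁻ x in Set.Ioc (0:ℝ) (1/2), ENNReal.ofReal (x ^ e * (1 - x) ^ d * (q.eval x) ^ 2)
        ≤ ∫⁻ x in Set.Ioc (0:ℝ) (1/2), ENNReal.ofReal (2 ^ |d|) *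
            ENNReal.ofReal (x ^ e * (q.eval x * q.eval x)) := by
          refine setLIntegral_mono' measurableSet_Ioc fun x hx => ?_
          rw [← ENNReal.ofReal_mul (by positivity)]
          refine ENNReal.ofReal_le_ofReal ?_
          have h1 := (bie_rpow_bounds (y := 1 - x) (d := d) (by linarith [hx.2])
            (by linarith [hx.1])).2
          have h2 : 0 ≤ x ^ e * (q.eval x * q.eval x) :=
            mul_nonneg (Real.rpow_nonneg hx.1.le _) (mul_self_nonneg _)
          calc _ = (1 - x) ^ d * (x ^ e * (q.eval x * q.eval x)) := by ring
            _ ≤ _ := by gcongr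
      _ = ENNReal.ofReal (2 ^ |d|) * ∫⁻ x in Set.Ioc (0:ℝ) (1/2),
            ENNReal.ofReal (x ^ e * (q.eval x * q.eval x)) :=
          lintegral_const_mul' _ _ ENNReal.ofReal_ne_top
      _ ≤ ENNReal.ofReal (2 ^ |d|) * (ENNReal.ofReal (C0 * N ^ s) *
          ∫⁻ x in Set.Ioc (0:ℝ) (1/2), ENNReal.ofReal (x ^ (e + s) * (q.eval x * q.eval x))) := by
          gcongr
          exact H p q hp hq
      _ ≤ ENNReal.ofReal (2 ^ |d|) * (ENNReal.ofReal (C0 * N ^ s) *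
          ∫⁻ x in Set.Ioc (0:ℝ) (1/2), ENNReal.ofReal (2 ^ |d|) *
            ENNReal.ofReal (x ^ (e + s) * (1 - x) ^ d * (q.eval x) ^ 2)) := by
          gcongr _ * (_ * ?_)
          refine setLIntegral_mono' measurableSet_Ioc fun x hx => ?_
          rw [← ENNReal.ofReal_mul (by positivity)]
          refine ENNReal.ofReal_le_ofReal ?_
          have h1 := (bie_rpow_bounds (y := 1 - x) (d := d) (by linarith [hx.2])
            (by linarith [hx.1])).1
          have h2 : 0 ≤ x ^ (e + s) * (q.eval x * q.eval x) :=
            mul_nonneg (Real.rpow_nonneg hx.1.le _) (mul_self_nonneg _)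
          have h3 : (2:ℝ) ^ |d| * (1 / 2) ^ |d| = 1 := by
            rw [← Real.mul_rpow (by norm_num) (by norm_num)]; norm_num
          calc _ = ((2:ℝ) ^ |d| * (1 / 2) ^ |d|) * (x ^ (e + s) * (q.eval x * q.eval x)) := by
                rw [h3, one_mul]
            _ ≤ ((2:ℝ) ^ |d| * (1 - x) ^ d) * (x ^ (e + s) * (q.eval x * q.eval x)) := by gcongr
            _ = _ := by ring
      _ = ENNReal.ofReal (2 ^ |d| * C0 * 2 ^ |d| * N ^ s) *
          ∫⁻ x in Set.Ioc (0:ℝ) (1/2),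
            ENNReal.ofReal (x ^ (e + s) * (1 - x) ^ d * (q.eval x) ^ 2) := by
          rw [lintegral_const_mul' _ _ ENNReal.ofReal_ne_top, ← mul_assoc, ← mul_assoc,
            ← ENNReal.ofReal_mul (by positivity), ← ENNReal.ofReal_mul (by positivity)]
          congr 2
          ring
      _ ≤ _ := by
          gcongr
          have : (0:ℝ) ≤ 2 ^ s := by positivity
          linarith
  · rw [← lintegral_const_mul' _ _ ENNReal.ofReal_ne_top]
    refine setLIntegral_mono' measurableSet_Ioo fun x hx => ?_
    rw [← ENNReal.ofReal_mul (by positivity)]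
    refine ENNReal.ofReal_le_ofReal ?_
    have hx0 : 0 < x := by linarith [hx.1]
    have h1 : 1 ≤ 2 ^ s * x ^ s := by
      rw [← Real.mul_rpow (by norm_num) hx0.le]
      exact Real.one_le_rpow (by linarith [hx.1]) hs
    have h2 : 0 ≤ x ^ e * (1 - x) ^ d * (q.eval x) ^ 2 :=
      mul_nonneg (mul_nonneg (Real.rpow_nonneg hx0.le _) (Real.rpow_nonneg (by linarith [hx.2]) _))
        (sq_nonneg _)
    rw [Real.rpow_add hx0]
    have h3 : 1 ≤ (2 ^ |d| * C0 * 2 ^ |d| + 2 ^ s) * N ^ s * x ^ s := by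
      have : 0 ≤ 2 ^ |d| * C0 * 2 ^ |d| * N ^ s * x ^ s := by positivity
      have h4 : 1 ≤ N ^ s * (2 ^ s * x ^ s) := one_le_mul_of_one_le_of_one_le hNs h1
      nlinarith
    calc _ ≤ _ := le_mul_of_one_le_left h2 h3
      _ = _ := by ring

/-- The open triangle. -/
def bieS : Set (ℝ × ℝ) := {z | 0 < z.1 ∧ 0 < z.2 ∧ z.1 + z.2 < 1}

lemma bieS_meas : MeasurableSet bieS :=
  (measurableSet_lt measurable_const measurable_fst).inter
    ((measurableSet_lt measurable_const measurable_snd).inter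
      (measurableSet_lt (measurable_fst.add measurable_snd) measurable_const))

lemma bieT_meas : MeasurableSet refTriangle :=
  (measurableSet_le measurable_const measurable_fst).inter
    ((measurableSet_le measurable_const measurable_snd).inter
      (measurableSet_le (measurable_fst.add measurable_snd) measurable_const))

lemma bieS_sub : bieS ⊆ refTriangle := fun _ hz => ⟨hz.1.le, hz.2.1.le, hz.2.2.le⟩

lemma bieT_ae : (refTriangle : Set (ℝ × ℝ)) =ᵐ[volume] bieS := by
  have h : volume (refTriangle \ bieS) = 0 := by
    rw [Measure.volume_eq_prod, Measure.measure_prod_null (bieT_meas.diff bieS_meas)]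
    have h0 : ∀ᵐ x : ℝ, x ≠ 0 := by simp [ae_iff]
    filter_upwards [h0] with x hx
    refine measure_mono_null (t := {0, 1 - x}) ?_ ((Set.toFinite _).measure_zero _)
    rintro y ⟨⟨h1, h2, h3⟩, h4⟩
    simp only at h1 h2 h3
    by_contra hne
    simp only [Set.mem_insert_iff, Set.mem_singleton_iff, not_or] at hne
    refine h4 ⟨lt_of_le_of_ne h1 (Ne.symm hx), lt_of_le_of_ne h2 (Ne.symm hne.1), ?_⟩
    refine lt_of_le_of_ne h3 fun h => hne.2 ?_
    simp only at h
    linarith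
  refine Filter.EventuallyLE.antisymm ?_ bieS_sub.eventuallyLE
  rw [ae_le_set]
  exact h

lemma bie_duffy (f : ℝ × ℝ → ENNReal) (hf : Measurable f) :
    ∫⁻ z in bieS, f z = ∫⁻ t in Set.Ioo (0:ℝ) 1, ∫⁻ x in Set.Ioo (0:ℝ) 1,
      ENNReal.ofReal (1 - x) * f (x, (1 - x) * t) := by
  rw [← lintegral_indicator bieS_meas, Measure.volume_eq_prod,
    lintegral_prod _ (hf.indicator bieS_meas).aemeasurable]
  have h1 : ∀ x : ℝ, ∫⁻ y, bieS.indicator f (x, y) = (Set.Ioo (0:ℝ) 1).indicator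
      (fun x => ∫⁻ t in Set.Ioo (0:ℝ) 1, ENNReal.ofReal (1 - x) * f (x, (1 - x) * t)) x := by
    intro x
    by_cases hx : x ∈ Set.Ioo (0:ℝ) 1
    · have hx1 : 0 < 1 - x := by linarith [hx.2]
      have hm : Measurable fun y => bieS.indicator f (x, y) :=
        (hf.indicator bieS_meas).comp measurable_prodMk_left
      have hsc : ∫⁻ y, bieS.indicator f (x, y) =
          ENNReal.ofReal (1 - x) • ∫⁻ t, bieS.indicator f (x, (1 - x) * t) := by
        conv_lhs => rw [← Real.smul_map_volume_mul_left hx1.ne']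
        rw [lintegral_smul_measure, lintegral_map hm (measurable_const_mul _), abs_of_pos hx1]
      rw [Set.indicator_of_mem hx, hsc, lintegral_const_mul' _ _ ENNReal.ofReal_ne_top,
        ← lintegral_indicator measurableSet_Ioo, smul_eq_mul]
      congr 2
      ext t
      have : (x, (1 - x) * t) ∈ bieS ↔ t ∈ Set.Ioo (0:ℝ) 1 := by
        constructor
        · rintro ⟨-, h2, h3⟩
          simp only at h2 h3
          exact ⟨pos_of_mul_pos_right h2 hx1.le, by
            by_contra hc
            nlinarith⟩
        · rintro ⟨h2, h3⟩
          refine ⟨hx.1, mul_pos hx1 h2, ?_⟩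
          simp only
          nlinarith
      by_cases ht : t ∈ Set.Ioo (0:ℝ) 1
      · rw [Set.indicator_of_mem ht, Set.indicator_of_mem (this.2 ht)]
      · rw [Set.indicator_of_notMem ht, Set.indicator_of_notMem (fun h => ht (this.1 h))]
    · rw [Set.indicator_of_notMem hx]
      have : ∀ y, bieS.indicator f (x, y) = 0 := fun y =>
        Set.indicator_of_notMem (fun h => hx ⟨h.1, by
          have := h.2.1
          have := h.2.2
          simp only at *
          linarith⟩) _
      simp [this]
  simp_rw [h1]
  rw [lintegral_indicator measurableSet_Ioo, lintegral_lintegral_swap]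
  refine Measurable.aemeasurable ?_
  have : Measurable fun z : ℝ × ℝ => f (z.1, (1 - z.1) * z.2) := hf.comp (by fun_prop)
  simp only [Function.uncurry_def]
  fun_prop

lemma bie_swap (f : ℝ × ℝ → ENNReal) (hf : Measurable f) :
    ∫⁻ z in bieS, f (z.2, z.1) = ∫⁻ z in bieS, f z := by
  have hm : Measurable (bieS.indicator f) := hf.indicator bieS_meas
  have h1 : ∀ z : ℝ × ℝ, bieS.indicator (fun z => f (z.2, z.1)) z = bieS.indicator f (z.2, z.1) := by
    intro z
    have : z ∈ bieS ↔ (z.2, z.1) ∈ bieS := by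
      simp only [bieS, Set.mem_ofPred_eq, add_comm z.1]
      tauto
    by_cases h : z ∈ bieS
    · rw [Set.indicator_of_mem h, Set.indicator_of_mem (this.1 h)]
    · rw [Set.indicator_of_notMem h, Set.indicator_of_notMem (fun h' => h (this.2 h'))]
  rw [← lintegral_indicator bieS_meas, ← lintegral_indicator bieS_meas]
  simp_rw [h1]
  have hm2 : Measurable fun z : ℝ × ℝ => bieS.indicator f (z.2, z.1) := hm.comp (by fun_prop)
  rw [Measure.volume_eq_prod, lintegral_prod _ hm2.aemeasurable,
    lintegral_prod_symm' _ hm]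

lemma bie_refl (f : ℝ × ℝ → ENNReal) (hf : Measurable f) :
    ∫⁻ z in bieS, f (1 - z.1 - z.2, z.2) = ∫⁻ z in bieS, f z := by
  have hm : Measurable (bieS.indicator f) := hf.indicator bieS_meas
  have h1 : ∀ z : ℝ × ℝ, bieS.indicator (fun z => f (1 - z.1 - z.2, z.2)) z =
      bieS.indicator f (1 - z.2 - z.1, z.2) := by
    intro z
    have : z ∈ bieS ↔ (1 - z.2 - z.1, z.2) ∈ bieS := by
      simp only [bieS, Set.mem_ofPred_eq]
      constructor <;> rintro ⟨h1, h2, h3⟩ <;> refine ⟨?_, ?_, ?_⟩ <;> linarith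
    rw [show 1 - z.2 - z.1 = 1 - z.1 - z.2 by ring] at *
    by_cases h : z ∈ bieS
    · rw [Set.indicator_of_mem h, Set.indicator_of_mem (this.1 h)]
    · rw [Set.indicator_of_notMem h, Set.indicator_of_notMem (fun h' => h (this.2 h'))]
  rw [← lintegral_indicator bieS_meas, ← lintegral_indicator bieS_meas]
  simp_rw [h1]
  have hm2 : Measurable fun z : ℝ × ℝ => bieS.indicator f (1 - z.2 - z.1, z.2) :=
    hm.comp (by fun_prop)
  rw [Measure.volume_eq_prod, lintegral_prod_symm' _ hm2,
    lintegral_prod_symm' _ hm]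
  congr 1
  ext y
  exact lintegral_sub_left_eq_self (fun x => bieS.indicator f (x, y)) (1 - y)

/-- The weighted squared norm. -/
noncomputable def bieJ (a b c : ℝ) (g : ℝ × ℝ → ℝ) : ENNReal :=
  ∫⁻ z in bieS, ENNReal.ofReal (z.1 ^ a * z.2 ^ b * (1 - z.1 - z.2) ^ c * g z ^ 2)

/-- Continuous functions whose restriction to every line is a polynomial of degree at most p. -/
def bieP (p : ℕ) (g : ℝ × ℝ → ℝ) : Prop :=
  Continuous g ∧ ∀ u0 u1 v0 v1 : ℝ, ∃ r : Polynomial ℝ, r.natDegree ≤ p ∧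
    ∀ s, r.eval s = g (u0 + u1 * s, v0 + v1 * s)

lemma bie_meas (a b c : ℝ) {g : ℝ × ℝ → ℝ} (hg : Continuous g) : Measurable fun z : ℝ × ℝ =>
    ENNReal.ofReal (z.1 ^ a * z.2 ^ b * (1 - z.1 - z.2) ^ c * g z ^ 2) := by
  have := hg.measurable
  fun_prop

lemma bieP_swap {p : ℕ} {g : ℝ × ℝ → ℝ} (hg : bieP p g) : bieP p (fun z => g (z.2, z.1)) := by
  refine ⟨hg.1.comp (by fun_prop), fun u0 u1 v0 v1 => ?_⟩
  obtain ⟨r, hr, h⟩ := hg.2 v0 v1 u0 u1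
  exact ⟨r, hr, h⟩

lemma bieP_refl {p : ℕ} {g : ℝ × ℝ → ℝ} (hg : bieP p g) :
    bieP p (fun z => g (1 - z.1 - z.2, z.2)) := by
  refine ⟨hg.1.comp (by fun_prop), fun u0 u1 v0 v1 => ?_⟩
  obtain ⟨r, hr, h⟩ := hg.2 (1 - u0 - v0) (-u1 - v1) v0 v1
  refine ⟨r, hr, fun s => ?_⟩
  rw [h]
  congr 2
  ring

lemma bieJ_swap (a b c : ℝ) {g : ℝ × ℝ → ℝ} (hg : Continuous g) :
    bieJ b a c (fun z => g (z.2, z.1)) = bieJ a b c g := by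
  unfold bieJ
  rw [← bie_swap _ (bie_meas a b c hg)]
  congr 1
  ext z
  congr 1
  simp only
  rw [show 1 - z.2 - z.1 = 1 - z.1 - z.2 by ring]
  ring

lemma bieJ_refl (a b c : ℝ) {g : ℝ × ℝ → ℝ} (hg : Continuous g) :
    bieJ c b a (fun z => g (1 - z.1 - z.2, z.2)) = bieJ a b c g := by
  unfold bieJ
  rw [← bie_refl _ (bie_meas a b c hg)]
  congr 1
  ext z
  congr 1
  simp only
  rw [show 1 - (1 - z.1 - z.2) - z.2 = z.1 by ring]
  ring

lemma bieJ_duffy (a b c : ℝ) {g : ℝ × ℝ → ℝ} (hg : Continuous g) :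
    bieJ a b c g = ∫⁻ t in Set.Ioo (0:ℝ) 1, ENNReal.ofReal (t ^ b * (1 - t) ^ c) *
      ∫⁻ x in Set.Ioo (0:ℝ) 1,
        ENNReal.ofReal (x ^ a * (1 - x) ^ (b + c + 1) * g (x, (1 - x) * t) ^ 2) := by
  unfold bieJ
  rw [bie_duffy _ (bie_meas a b c hg)]
  refine setLIntegral_congr_fun measurableSet_Ioo fun t ht => ?_
  simp only
  rw [← lintegral_const_mul' _ _ ENNReal.ofReal_ne_top]
  refine setLIntegral_congr_fun measurableSet_Ioo fun x hx => ?_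
  have hx1 : 0 < 1 - x := by linarith [hx.2]
  have ht1 : 0 < 1 - t := by linarith [ht.2]
  rw [← ENNReal.ofReal_mul hx1.le, ← ENNReal.ofReal_mul
    (mul_nonneg (Real.rpow_nonneg ht.1.le _) (Real.rpow_nonneg ht1.le _)),
    show 1 - x - (1 - x) * t = (1 - x) * (1 - t) by ring, Real.mul_rpow hx1.le ht.1.le,
    Real.mul_rpow hx1.le ht1.le, Real.rpow_add_one hx1.ne', Real.rpow_add hx1]
  congr 1
  ring

lemma bie_dirX {a s : ℝ} (b c : ℝ) (ha : -1 < a) (hs : 0 ≤ s) : ∃ C : ℝ, 0 < C ∧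
    ∀ (p : ℕ) (g : ℝ × ℝ → ℝ), 1 ≤ p → bieP p g →
      bieJ a b c g ≤ ENNReal.ofReal (C * ((p : ℝ) ^ 2) ^ s) * bieJ (a + s) b c g := by
  obtain ⟨C, hC, H⟩ := bie_oneD_w (b + c + 1) ha hs
  refine ⟨C, hC, fun p g hp hg => ?_⟩
  rw [bieJ_duffy _ _ _ hg.1, bieJ_duffy _ _ _ hg.1, ← lintegral_const_mul' _ _ ENNReal.ofReal_ne_top]
  refine lintegral_mono fun t => ?_
  obtain ⟨r, hr, h⟩ := hg.2 0 1 t (-t)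
  have h' : ∀ x, g (x, (1 - x) * t) = r.eval x := by
    intro x
    rw [h]
    congr 2 <;> ring
  simp only [h']
  rw [mul_left_comm]
  gcongr
  exact H p r hp hr

lemma bie_vertex {α β : ℝ} (hα : -1 < α) (hαβ : α ≤ β) : ∃ C : ℝ, 0 < C ∧
    ∀ (p : ℕ) (g : ℝ × ℝ → ℝ), 1 ≤ p → bieP p g →
      bieJ α α β g ≤ ENNReal.ofReal (C * (p : ℝ) ^ (4 * (β - α))) * bieJ β β β g := by
  obtain ⟨C1, h1, H1⟩ := bie_dirX (s := β - α) α β hα (by linarith)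
  obtain ⟨C2, h2, H2⟩ := bie_dirX (s := β - α) β β hα (by linarith)
  rw [add_sub_cancel] at H1 H2
  refine ⟨C1 * C2, by positivity, fun p g hp hg => ?_⟩
  have hp' : (0:ℝ) < p := by exact_mod_cast hp
  calc bieJ α α β g ≤ _ := H1 p g hp hg
    _ = _ := by rw [← bieJ_swap _ _ _ hg.1]
    _ ≤ _ := mul_le_mul_right (H2 p _ hp (bieP_swap hg)) _
    _ = _ := by
      rw [bieJ_swap _ _ _ hg.1, ← mul_assoc, ← ENNReal.ofReal_mul (by positivity)]
      congr 2
      rw [show 4 * (β - α) = 2 * (β - α) + 2 * (β - α) by ring, Real.rpow_add hp',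
        Real.rpow_mul hp'.le, Real.rpow_two]
      ring

lemma bie_third {y α β : ℝ} (hy : 1 / 3 ≤ y) (h : α ≤ β) : y ^ α ≤ 3 ^ (β - α) * y ^ β := by
  have hy0 : 0 < y := by linarith
  have h1 : 1 ≤ (3 : ℝ) ^ (β - α) * y ^ (β - α) := by
    rw [← Real.mul_rpow (by norm_num) hy0.le]
    exact Real.one_le_rpow (by linarith) (by linarith)
  have h2 : y ^ β = y ^ α * y ^ (β - α) := by rw [← Real.rpow_add hy0]; congr 1; ring
  rw [h2]
  have := Real.rpow_pos_of_pos hy0 α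
  nlinarith

lemma bie_split {α β : ℝ} (hαβ : α ≤ β) {g : ℝ × ℝ → ℝ} (hg : Continuous g) :
    bieJ α α α g ≤ ENNReal.ofReal (3 ^ (β - α)) *
      (bieJ β α α g + bieJ α β α g + bieJ α α β g) := by
  unfold bieJ
  rw [← lintegral_add_left (bie_meas _ _ _ hg), ← lintegral_add_right _ (bie_meas _ _ _ hg),
    ← lintegral_const_mul' _ _ ENNReal.ofReal_ne_top]
  refine setLIntegral_mono' bieS_meas fun z hz => ?_
  obtain ⟨h1, h2, h3⟩ := hz
  have h4 : 0 < 1 - z.1 - z.2 := by linarith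
  have p1 := fun r => Real.rpow_pos_of_pos h1 r
  have p2 := fun r => Real.rpow_pos_of_pos h2 r
  have p3 := fun r => Real.rpow_pos_of_pos h4 r
  have hgz := sq_nonneg (g z)
  have n1 := p1 α
  have n2 := p1 β
  have n3 := p2 α
  have n4 := p2 β
  have n5 := p3 α
  have n6 := p3 β
  rw [← ENNReal.ofReal_add (by positivity) (by positivity),
    ← ENNReal.ofReal_add (by positivity) (by positivity), ← ENNReal.ofReal_mul (by positivity)]
  refine ENNReal.ofReal_le_ofReal ?_
  have hor : 1 / 3 ≤ z.1 ∨ 1 / 3 ≤ z.2 ∨ 1 / 3 ≤ 1 - z.1 - z.2 := by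
    by_contra! hc
    linarith [hc.1, hc.2.1, hc.2.2]
  rw [mul_add, mul_add]
  have q1 : 0 ≤ (3:ℝ) ^ (β - α) * (z.1 ^ β * z.2 ^ α * (1 - z.1 - z.2) ^ α * g z ^ 2) := by positivity
  have q2 : 0 ≤ (3:ℝ) ^ (β - α) * (z.1 ^ α * z.2 ^ β * (1 - z.1 - z.2) ^ α * g z ^ 2) := by positivity
  have q3 : 0 ≤ (3:ℝ) ^ (β - α) * (z.1 ^ α * z.2 ^ α * (1 - z.1 - z.2) ^ β * g z ^ 2) := by positivity
  rcases hor with h | h | h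
  · have := mul_le_mul_of_nonneg_right (bie_third h hαβ)
      (by positivity : 0 ≤ z.2 ^ α * (1 - z.1 - z.2) ^ α * g z ^ 2)
    nlinarith
  · have := mul_le_mul_of_nonneg_right (bie_third h hαβ)
      (by positivity : 0 ≤ z.1 ^ α * (1 - z.1 - z.2) ^ α * g z ^ 2)
    nlinarith
  · have := mul_le_mul_of_nonneg_right (bie_third h hαβ)
      (by positivity : 0 ≤ z.1 ^ α * z.2 ^ α * g z ^ 2)
    nlinarith

lemma bie_main {α β : ℝ} (hα : -1 < α) (hαβ : α ≤ β) : ∃ C : ℝ, 0 < C ∧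
    ∀ (p : ℕ) (g : ℝ × ℝ → ℝ), 1 ≤ p → bieP p g →
      bieJ α α α g ≤ ENNReal.ofReal (C * (p : ℝ) ^ (4 * (β - α))) * bieJ β β β g := by
  obtain ⟨C, hC, H⟩ := bie_vertex hα hαβ
  refine ⟨3 ^ (β - α) * (3 * C), by positivity, fun p g hp hg => ?_⟩
  set P := (p:ℝ) ^ (4 * (β - α)) with hP
  have hP0 : 0 ≤ P := by positivity
  have A : ∀ g, bieP p g → bieJ β α α g ≤ ENNReal.ofReal (C * P) * bieJ β β β g := by
    intro g hg
    rw [← bieJ_refl _ _ _ hg.1, ← bieJ_refl β β β hg.1]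
    exact H p _ hp (bieP_refl hg)
  have B : bieJ α β α g ≤ ENNReal.ofReal (C * P) * bieJ β β β g := by
    rw [← bieJ_swap _ _ _ hg.1, ← bieJ_swap β β β hg.1]
    exact A _ (bieP_swap hg)
  calc _ ≤ _ := bie_split hαβ hg.1
    _ ≤ ENNReal.ofReal (3 ^ (β - α)) * (ENNReal.ofReal (C * P) * bieJ β β β g +
        ENNReal.ofReal (C * P) * bieJ β β β g + ENNReal.ofReal (C * P) * bieJ β β β g) := by
      gcongr
      · exact A g hg
      · exact H p g hp hg
    _ = _ := by
      rw [← add_mul, ← add_mul, ← ENNReal.ofReal_add (by positivity) (by positivity),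
        ← ENNReal.ofReal_add (by positivity) (by positivity), ← mul_assoc,
        ← ENNReal.ofReal_mul (by positivity)]
      congr 2
      ring

lemma bie_lint_rpow {β : ℝ} (hβ : -1 < β) :
    ∫⁻ x in Set.Ioo (0:ℝ) 1, ENNReal.ofReal (x ^ β) < ⊤ := by
  have h : IntegrableOn (fun x : ℝ => x ^ β) (Set.Ioo 0 1) :=
    (intervalIntegral.intervalIntegrable_rpow' (a := 0) (b := 1) hβ).1.mono_set Set.Ioo_subset_Ioc_self
  exact h.lintegral_lt_top

lemma bie_lint_rpow' {β : ℝ} (hβ : -1 < β) :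
    ∫⁻ x in Set.Ioo (0:ℝ) 1, ENNReal.ofReal ((1 - x) ^ β) < ⊤ := by
  have h1 := (intervalIntegral.intervalIntegrable_rpow' (a := 1) (b := 0) hβ).comp_sub_left 1
  simp only [sub_self, sub_zero] at h1
  have h : IntegrableOn (fun x : ℝ => (1 - x) ^ β) (Set.Ioo 0 1) :=
    h1.1.mono_set Set.Ioo_subset_Ioc_self
  exact h.lintegral_lt_top

lemma bie_finite {β : ℝ} (hβ : -1 / 2 < β) {g : ℝ × ℝ → ℝ} (hg : Continuous g) :
    bieJ β β β g < ⊤ := by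
  obtain ⟨M, hM⟩ : ∃ M : ℝ, ∀ z ∈ Set.Icc (0:ℝ) 1 ×ˢ Set.Icc (0:ℝ) 1, g z ^ 2 ≤ M := by
    obtain ⟨M, hM⟩ := ((isCompact_Icc (a := (0:ℝ)) (b := 1)).prod
      (isCompact_Icc (a := (0:ℝ)) (b := 1))).bddAbove_image (f := fun z => g z ^ 2)
      (by fun_prop)
    exact ⟨M, fun z hz => hM ⟨z, hz, rfl⟩⟩
  have hM0 : 0 ≤ M := (sq_nonneg _).trans (hM (0, 0) (by simp))
  rw [bieJ_duffy _ _ _ hg]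
  calc _ ≤ ∫⁻ t in Set.Ioo (0:ℝ) 1, (ENNReal.ofReal (2 ^ |β|) *
        (ENNReal.ofReal (t ^ β) + ENNReal.ofReal ((1 - t) ^ β))) *
        (ENNReal.ofReal M * ∫⁻ x in Set.Ioo (0:ℝ) 1, ENNReal.ofReal (x ^ β)) := by
        refine setLIntegral_mono' measurableSet_Ioo fun t ht => ?_
        have ht1 : 0 < 1 - t := by linarith [ht.2]
        have k1 := Real.rpow_pos_of_pos ht.1 β
        have k2 := Real.rpow_pos_of_pos ht1 β
        refine mul_le_mul' ?_ ?_
        · rw [← ENNReal.ofReal_add k1.le k2.le, ← ENNReal.ofReal_mul (by positivity)]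
          refine ENNReal.ofReal_le_ofReal ?_
          have k3 : (0:ℝ) < 2 ^ |β| := by positivity
          rcases le_total t (1 / 2) with h | h
          · have := (bie_rpow_bounds (y := 1 - t) (d := β) (by linarith) (by linarith [ht.1])).2
            nlinarith [mul_pos k3 k2]
          · have := (bie_rpow_bounds (y := t) (d := β) (by linarith) (by linarith [ht.2])).2
            nlinarith [mul_pos k3 k1]
        · rw [← lintegral_const_mul' _ _ ENNReal.ofReal_ne_top]
          refine setLIntegral_mono' measurableSet_Ioo fun x hx => ?_
          rw [← ENNReal.ofReal_mul hM0]
          refine ENNReal.ofReal_le_ofReal ?_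
          have hx1 : 0 < 1 - x := by linarith [hx.2]
          have k3 : (1 - x) ^ (β + β + 1) ≤ 1 :=
            Real.rpow_le_one hx1.le (by linarith [hx.1]) (by linarith)
          have k4 : 0 ≤ (1 - x) ^ (β + β + 1) := Real.rpow_nonneg hx1.le _
          have k5 := Real.rpow_pos_of_pos hx.1 β
          have k6 : g (x, (1 - x) * t) ^ 2 ≤ M := by
            refine hM _ ⟨⟨hx.1.le, hx.2.le⟩, ⟨(mul_pos hx1 ht.1).le, ?_⟩⟩
            simp only
            nlinarith [hx.1, ht.1, ht.2]
          calc _ ≤ x ^ β * 1 * M := by gcongr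
            _ = _ := by ring
    _ < ⊤ := by
        rw [lintegral_mul_const', lintegral_const_mul' _ _ ENNReal.ofReal_ne_top,
          lintegral_add_left (by fun_prop)]
        · have f1 := bie_lint_rpow (β := β) (by linarith)
          have f2 := bie_lint_rpow' (β := β) (by linarith)
          exact ENNReal.mul_lt_top (ENNReal.mul_lt_top ENNReal.ofReal_lt_top
            (ENNReal.add_lt_top.2 ⟨f1, f2⟩)) (ENNReal.mul_lt_top ENNReal.ofReal_lt_top f1)
        · exact (ENNReal.mul_lt_top ENNReal.ofReal_lt_top (bie_lint_rpow (by linarith))).ne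

lemma bie_integral_eq (γ : ℝ) {g : ℝ × ℝ → ℝ} (hg : Continuous g) :
    ∫ z in refTriangle, (z.1 * z.2 * (1 - z.1 - z.2)) ^ γ * g z ^ 2 = (bieJ γ γ γ g).toReal := by
  rw [setIntegral_congr_set bieT_ae, integral_eq_lintegral_of_nonneg_ae]
  · unfold bieJ
    congr 1
    refine setLIntegral_congr_fun bieS_meas fun z hz => ?_
    obtain ⟨h1, h2, h3⟩ := hz
    rw [Real.mul_rpow (by positivity) (by linarith), Real.mul_rpow h1.le h2.le]
  · filter_upwards [ae_restrict_mem bieS_meas] with z hz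
    obtain ⟨h1, h2, h3⟩ := hz
    have : 0 ≤ 1 - z.1 - z.2 := by linarith
    simp only [Pi.zero_apply]
    positivity
  · have := hg.measurable
    refine Measurable.aestronglyMeasurable ?_
    fun_prop

lemma bieP_poly {p : ℕ} {q : MvPolynomial (Fin 2) ℝ} (hq : q.totalDegree ≤ p) :
    bieP p (fun z => MvPolynomial.eval ![z.1, z.2] q) := by
  constructor
  · refine (MvPolynomial.continuous_eval q).comp ?_
    refine continuous_pi fun i => ?_
    fin_cases i
    · exact continuous_fst
    · exact continuous_snd
  · intro u0 u1 v0 v1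
    refine ⟨MvPolynomial.aeval ![Polynomial.C u1 * Polynomial.X + Polynomial.C u0,
      Polynomial.C v1 * Polynomial.X + Polynomial.C v0] q, ?_, fun s => ?_⟩
    · have := MvPolynomial.aeval_natDegree_le q hq ![Polynomial.C u1 * Polynomial.X + Polynomial.C u0,
        Polynomial.C v1 * Polynomial.X + Polynomial.C v0] (n := 1) (by
          intro i
          fin_cases i
          · exact Polynomial.natDegree_linear_le
          · exact Polynomial.natDegree_linear_le)
      simpa using this
    · have h1 : (MvPolynomial.aeval ![Polynomial.C u1 * Polynomial.X + Polynomial.C u0,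
          Polynomial.C v1 * Polynomial.X + Polynomial.C v0] q).eval s =
          MvPolynomial.eval (fun i => (![Polynomial.C u1 * Polynomial.X + Polynomial.C u0,
          Polynomial.C v1 * Polynomial.X + Polynomial.C v0] i).eval s) q := by
        rw [← Polynomial.coe_evalRingHom, MvPolynomial.aeval_def, MvPolynomial.hom_eval₂]
        rw [MvPolynomial.eval, MvPolynomial.coe_eval₂Hom]
        congr 1
        ext x
        simp
      rw [h1]
      congr 2
      funext i
      fin_cases i <;> simp [add_comm]

/-- $hp$-polynomial inverse estimate with bubbles on the
reference triangle (Proposition 3.5 of the paper, d = 2, triangle case). -/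
theorem bubble_inverse_estimate_triangle (α β : ℝ) (hα : -1 / 2 < α) (hαβ : α ≤ β) :
    ∃ c : ℝ, 0 < c ∧
      ∀ p : ℕ, 1 ≤ p → ∀ q : MvPolynomial (Fin 2) ℝ, q.totalDegree ≤ p →
        ∫ z in refTriangle,
            (z.1 * z.2 * (1 - z.1 - z.2)) ^ α * (MvPolynomial.eval ![z.1, z.2] q) ^ 2 ≤
          c * (p : ℝ) ^ (4 * (β - α)) *
            ∫ z in refTriangle,
              (z.1 * z.2 * (1 - z.1 - z.2)) ^ β * (MvPolynomial.eval ![z.1, z.2] q) ^ 2 := by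
  obtain ⟨C, hC, H⟩ := bie_main (by linarith : -1 < α) hαβ
  refine ⟨C, hC, fun p hp q hq => ?_⟩
  have hg := bieP_poly hq
  rw [bie_integral_eq α hg.1, bie_integral_eq β hg.1]
  have h1 := H p _ hp hg
  have h2 := bie_finite (β := β) (by linarith) hg.1
  have h3 := ENNReal.toReal_mono (ENNReal.mul_lt_top ENNReal.ofReal_lt_top h2).ne h1
  rwa [ENNReal.toReal_mul, ENNReal.toReal_ofReal (by positivity)] at h3
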